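/- arXiv:1403.4385 — 2 statements merged into one kernel-verified Lean document; each statement's English description precedes it below -/
import Mathlib

section
/- Let A and B be simple unital complex C*-algebras, φ : GL(A) → GL(B) a group isomorphism, and θ the induced map on idempotents. Then for every nontrivial idempotent e ∈ Ĩ(A) there exist group homomorphisms a_e, b_e from the multiplicative group ℂ∖{0} to itself such that φ(λe + 1 − e) = a_e(λ) θ(e) + b_e(λ) θ(1 − e) for every nonzero λ ∈ ℂ. -/
noncomputable section

/-- The symmetry `1 - 2e` associated to an idempotent `e` is a unit (its own inverse). -/
def symUnit {A : Type*} [Ring A] {e : A} (he : IsIdempotentElem e) : Aˣ where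
  val := 1 - 2 * e
  inv := 1 - 2 * e
  val_inv := by
    have h : e * e = e := he
    have expand : (1 - 2 * e) * (1 - 2 * e) = 1 - 4 * e + 4 * (e * e) := by noncomm_ring
    rw [expand, h]; noncomm_ring
  inv_val := by
    have h : e * e = e := he
    have expand : (1 - 2 * e) * (1 - 2 * e) = 1 - 4 * e + 4 * (e * e) := by noncomm_ring
    rw [expand, h]; noncomm_ring

/-- The map `θ_φ` induced on idempotents by a map `φ` between the groups of invertible
elements, determined by `1 - 2 θ_φ(e) = φ(1 - 2e)`, i.e. `θ_φ(e) = (1 - φ(1 - 2e))/2`;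
it is extended by `0` off the set of idempotents. -/
noncomputable def theta {A B : Type*} [Ring A] [Ring B] [Algebra ℂ B]
    (φ : Aˣ → Bˣ) (e : A) : B :=
  letI := Classical.propDecidable (IsIdempotentElem e)
  if h : IsIdempotentElem e then (2 : ℂ)⁻¹ • ((1 : B) - (φ (symUnit h) : B)) else 0

/-- `a` and `b` are coefficient maps for the idempotent `e` (w.r.t. `φ`):
`φ(λe + 1 - e) = a(λ) θ(e) + b(λ) θ(1-e)` for all nonzero `λ`. -/
def IsCoeffMaps {A B : Type*} [Ring A] [Ring B] [Algebra ℂ A] [Algebra ℂ B]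
    (φ : Aˣ → Bˣ) (e : A) (a b : ℂˣ →* ℂˣ) : Prop :=
  ∀ (lam : ℂˣ) (v : Aˣ), (v : A) = (lam : ℂ) • e + 1 - e →
    (φ v : B) = ((a lam : ℂˣ) : ℂ) • theta φ e + ((b lam : ℂˣ) : ℂ) • theta φ (1 - e)

/-- `c(λ) = a(λ) b(λ)⁻¹`, as an element of `ℂˣ`. -/
def cOf (a b : ℂˣ →* ℂˣ) (lam : ℂˣ) : ℂˣ := a lam * (b lam)⁻¹

variable {A B : Type*}
  [NormedRing A] [StarRing A] [CStarRing A] [CompleteSpace A]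
  [NormedAlgebra ℂ A] [StarModule ℂ A]
  [NormedRing B] [StarRing B] [CStarRing B] [CompleteSpace B]
  [NormedAlgebra ℂ B] [StarModule ℂ B]


section Helpers

/-- In a simple ring, if `y` commutes with `f` and with the corner `f R f`, and `y * f ≠ 0`, then
`y * f` has a right inverse in the corner. -/
theorem exists_corner_inverse {R : Type*} [Ring R] [IsSimpleRing R] {f y : R}
    (hf : IsIdempotentElem f) (hyf : Commute y f) (hy : ∀ p, Commute y (f * p * f))
    (hne : y * f ≠ 0) : ∃ c, y * (f * c * f) = f := by
  have hf' : f * f = f := hf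
  let I : TwoSidedIdeal R := TwoSidedIdeal.mk'
    {x | ∀ p q, ∃ c, f * p * x * q * f = y * (f * c * f)}
    (fun p q => ⟨0, by simp⟩)
    (by
      intro x x' hx hx' p q
      obtain ⟨c, hc⟩ := hx p q
      obtain ⟨c', hc'⟩ := hx' p q
      exact ⟨c + c', by simp only [mul_add, add_mul, hc, hc']⟩)
    (by
      intro x hx p q
      obtain ⟨c, hc⟩ := hx p q
      exact ⟨-c, by simp only [mul_neg, neg_mul, hc]⟩)
    (by
      intro r x hx p q
      obtain ⟨c, hc⟩ := hx (p * r) q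
      exact ⟨c, by simpa only [mul_assoc] using hc⟩)
    (by
      intro x r hx p q
      obtain ⟨c, hc⟩ := hx p (r * q)
      exact ⟨c, by simpa only [mul_assoc] using hc⟩)
  have hmem : ∀ x, x ∈ I ↔ ∀ p q, ∃ c, f * p * x * q * f = y * (f * c * f) := by
    intro x
    exact TwoSidedIdeal.mem_mk' _ _ _ _ _ _ _
  have hyI : y * f ∈ I := by
    rw [hmem]
    intro p q
    refine ⟨p * f * q, ?_⟩
    have h1 : f * p * (y * f) = y * (f * p * f) := by
      rw [(hy p).eq, hyf.eq, mul_assoc (f * p) f y, ← hyf.eq]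
    rw [h1]
    simp only [mul_assoc]
  have hI : I = ⊤ := by
    rcases eq_bot_or_eq_top I with h | h
    · rw [h, TwoSidedIdeal.mem_bot] at hyI
      exact absurd hyI hne
    · exact h
  have h1 : (1 : R) ∈ I := by rw [hI]; trivial
  obtain ⟨c, hc⟩ := (hmem 1).1 h1 1 1
  exact ⟨c, by rw [← hc]; simp [hf']⟩

/-- In a simple complex Banach algebra, an element commuting with the commutant of a nonzero
idempotent `f` acts on `f` as a scalar. -/
theorem exists_mul_idempotent_eq_smul {B : Type*} [NormedRing B] [NormedAlgebra ℂ B]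
    [CompleteSpace B] [IsSimpleRing B] {f w : B} (hf : IsIdempotentElem f) (hf0 : f ≠ 0)
    (hw : ∀ x, Commute x f → Commute w x) : ∃ a : ℂ, w * f = a • f := by
  have hf' : f * f = f := hf
  have hwf : Commute w f := hw f (Commute.refl f)
  have hcorner : ∀ p, Commute w (f * p * f) := fun p => hw _ <| by
    change f * p * f * f = f * (f * p * f)
    rw [mul_assoc _ f f, hf', ← mul_assoc f _ f, ← mul_assoc f f p, hf']
  let E : Submodule ℂ B :=
    (ContinuousLinearMap.mul ℂ B f - ContinuousLinearMap.id ℂ B).ker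
  have hE : ∀ x, x ∈ E ↔ f * x = x := fun x => by
    simp [E, LinearMap.mem_ker, sub_eq_zero]
  have : CompleteSpace E :=
    (ContinuousLinearMap.isClosed_ker
      (ContinuousLinearMap.mul ℂ B f - ContinuousLinearMap.id ℂ B)).completeSpace_coe
  have : Nontrivial E := ⟨⟨⟨f, (hE f).2 hf'⟩, 0, fun h => hf0 (congrArg Subtype.val h)⟩⟩
  let mulE (x : B) (hx : Commute x f) : E →L[ℂ] E :=
    ((ContinuousLinearMap.mul ℂ B x).comp E.subtypeL).codRestrict E (fun z => by
      rw [hE]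
      change f * (x * z) = x * z
      rw [← mul_assoc, ← hx.eq, mul_assoc, (hE z).1 z.2])
  have hmulE : ∀ x hx z, (mulE x hx z : B) = x * z := fun _ _ _ => rfl
  obtain ⟨a, ha⟩ := spectrum.nonempty (mulE w hwf)
  refine ⟨a, ?_⟩
  by_contra hne
  apply ha
  have halg : ∀ x, Commute (algebraMap ℂ B a) x := Algebra.commutes a
  obtain ⟨c, hc⟩ := exists_corner_inverse (y := algebraMap ℂ B a - w) hf
    ((halg f).sub_left hwf) (fun p => (halg _).sub_left (hcorner p)) (by
      rw [sub_mul, ← Algebra.smul_def]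
      exact fun h => hne (sub_eq_zero.1 h).symm)
  have hcf : Commute (f * c * f) f := by
    change f * c * f * f = f * (f * c * f)
    rw [mul_assoc _ f f, hf', ← mul_assoc f _ f, ← mul_assoc f f c, hf']
  have hc' : (f * c * f) * (algebraMap ℂ B a - w) = f := by
    rw [← ((halg _).sub_left (hcorner c)).eq, hc]
  have hval : ∀ z : E, ((algebraMap ℂ (E →L[ℂ] E) a - mulE w hwf) z : B) =
      (algebraMap ℂ B a - w) * z := fun z => by
    simp [hmulE, sub_mul, Algebra.algebraMap_eq_smul_one]
  refine ⟨⟨algebraMap ℂ (E →L[ℂ] E) a - mulE w hwf, mulE (f * c * f) hcf, ?_, ?_⟩, rfl⟩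
  · ext z
    rw [mul_apply_eq_comp, hval, hmulE _ hcf, ← mul_assoc, hc, (hE z).1 z.2]
    rfl
  · ext z
    rw [mul_apply_eq_comp, hmulE _ hcf, hval, ← mul_assoc, hc', (hE z).1 z.2]
    rfl

/-- An element commuting with all units commuting with `s` commutes with everything commuting
with `s`. -/
theorem commute_of_commute_units {B : Type*} [NormedRing B] [NormedAlgebra ℂ B]
    [CompleteSpace B] {s w : B} (h : ∀ u : Bˣ, Commute (u : B) s → Commute w u)
    {x : B} (hx : Commute x s) : Commute w x := by
  obtain ⟨t, ht⟩ : ∃ t : ℂ, t ∉ spectrum ℂ x := by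
    by_contra! hall
    exact NormedSpace.unbounded_univ ℂ ℂ
      ((spectrum.isBounded x).subset fun t _ => hall t)
  obtain ⟨u, hu⟩ := spectrum.notMem_iff.1 ht
  have halg : ∀ z, Commute (algebraMap ℂ B t) z := Algebra.commutes t
  have h1 := h u (by rw [hu]; exact (halg s).sub_left hx)
  rw [hu] at h1
  simpa using (halg w).symm.sub_right h1

/-- Pointwise eigenvalues of a representation on a nonzero vector form a character. -/
theorem exists_character {G B : Type*} [Group G] [Ring B] [Algebra ℂ B] (W : G →* B) {f : B}
    (hf0 : f ≠ 0) (h : ∀ g, ∃ a : ℂ, W g * f = a • f) :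
    ∃ a : G →* ℂˣ, ∀ g, W g * f = (a g : ℂ) • f := by
  choose a ha using h
  have hinj : Function.Injective fun c : ℂ => c • f := smul_left_injective ℂ hf0
  let a' : G →* ℂ :=
    { toFun := a
      map_one' := hinj (by simp [← ha])
      map_mul' := fun g g' => hinj (by
        simp only [← ha, map_mul, mul_assoc]
        rw [ha g', mul_smul_comm, ha g, smul_smul, mul_comm]) }
  exact ⟨a'.toHomUnits, ha⟩

/-- The one-parameter group `λ ↦ λe + 1 - e` attached to an idempotent `e`. -/
def idempotentUnits {A : Type*} [Ring A] [Algebra ℂ A] {e : A} (he : IsIdempotentElem e) :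
    ℂˣ →* Aˣ :=
  MonoidHom.toHomUnits
    { toFun := fun t => (t : ℂ) • e + 1 - e
      map_one' := by simp
      map_mul' := fun s t => by
        have h : e * e = e := he
        simp only [Units.val_mul, mul_sub, sub_mul, mul_add, add_mul, h,
          mul_one, one_mul, smul_mul_assoc, mul_smul_comm]
        module }

theorem idempotentUnits_val {A : Type*} [Ring A] [Algebra ℂ A] {e : A}
    (he : IsIdempotentElem e) (t : ℂˣ) :
    (idempotentUnits he t : A) = (t : ℂ) • e + 1 - e := rfl

theorem symUnit_mul_self {A : Type*} [Ring A] {e : A} (he : IsIdempotentElem e) :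
    symUnit he * symUnit he = 1 := Units.ext (symUnit he).val_inv

theorem symUnit_one_sub {A : Type*} [Ring A] {e : A} (he : IsIdempotentElem e)
    (he' : IsIdempotentElem (1 - e)) : symUnit he' = -1 * symUnit he := by
  ext
  simp only [symUnit, Units.val_mul, Units.val_neg, Units.val_one]
  noncomm_ring

theorem symUnit_eq_one {A : Type*} [Ring A] [Algebra ℂ A] {e : A} (he : IsIdempotentElem e)
    (h : symUnit he = 1) : e = 0 := by
  have h1 : (1 : A) - 2 * e = 1 := congrArg Units.val h
  have h2 : (2 : ℂ) • e = 0 := by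
    rw [two_smul, ← two_mul]
    exact sub_eq_self.1 h1
  exact (smul_eq_zero.1 h2).resolve_left two_ne_zero

theorem commute_of_commute_symUnit {A : Type*} [Ring A] [Algebra ℂ A] {e x : A}
    (he : IsIdempotentElem e) (h : Commute x (symUnit he : A)) : Commute x e := by
  have h1 : e = (2 : ℂ)⁻¹ • (1 - (symUnit he : A)) := by
    simp only [symUnit, sub_sub_cancel, two_mul, ← two_smul ℂ e, smul_smul]
    norm_num
  rw [h1]
  exact ((Commute.one_right x).sub_right h).smul_right _

theorem map_neg_one_units {A B : Type*} [Ring A] [Algebra ℂ A] [Nontrivial A] [NormedRing B]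
    [NormedAlgebra ℂ B] [CompleteSpace B] [IsSimpleRing B] (φ : Aˣ ≃* Bˣ) : φ (-1) = -1 := by
  obtain ⟨a, ha⟩ := exists_mul_idempotent_eq_smul (w := (φ (-1) : B)) (f := 1)
    (IsIdempotentElem.one) one_ne_zero (fun x hx => commute_of_commute_units (s := 1) (by
      intro u _
      have h : φ (-1) * u = u * φ (-1) := by
        obtain ⟨v, rfl⟩ := φ.surjective u
        rw [← map_mul, ← map_mul]
        simp
      exact congrArg Units.val h) hx)
  rw [mul_one] at ha
  have hsq : (φ (-1) : B) * φ (-1) = 1 := by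
    rw [← Units.val_mul, ← map_mul]
    simp
  rw [ha, smul_mul_smul_comm, one_mul] at hsq
  have ha2 : a * a = 1 :=
    smul_left_injective ℂ (one_ne_zero (α := B)) (by simpa using hsq)
  rcases mul_self_eq_one_iff.1 ha2 with rfl | rfl
  · have h1 : φ (-1) = φ 1 := Units.ext (by simpa using ha)
    have h2 : (-1 : A) = 1 := congrArg Units.val (φ.injective h1)
    have h3 : (2 : ℂ) • (1 : A) = 0 := by
      rw [two_smul]
      nth_rewrite 1 [← h2]
      simp
    exact absurd h3 (smul_ne_zero two_ne_zero one_ne_zero)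
  · exact Units.ext (by simpa using ha)

end Helpers

theorem statement5 [IsSimpleRing A] [IsSimpleRing B] (φ : Aˣ ≃* Bˣ)
    (e : A) (he : IsIdempotentElem e) (he0 : e ≠ 0) (he1 : e ≠ 1) :
    ∃ a b : ℂˣ →* ℂˣ, IsCoeffMaps (⇑φ) e a b := by
  have he' : IsIdempotentElem (1 - e) := he.one_sub
  set s : B := (φ (symUnit he) : B) with hs
  have hss : s * s = 1 := by
    rw [hs, ← Units.val_mul, ← map_mul, symUnit_mul_self, map_one, Units.val_one]
  have hsym : φ (symUnit he') = -φ (symUnit he) := by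
    rw [symUnit_one_sub he he', map_mul, map_neg_one_units, neg_one_mul]
  have hθ : theta φ e = (2 : ℂ)⁻¹ • (1 - s) := by simp [theta, he, hs]
  have hθ' : theta φ (1 - e) = (2 : ℂ)⁻¹ • (1 + s) := by
    rw [theta, dif_pos he', hsym]
    simp [hs]
  set f := theta φ e with hf
  have hadd : f + theta φ (1 - e) = 1 := by rw [hθ, hθ']; module
  have hfs : s = 1 - (2 : ℂ) • f := by rw [hθ]; module
  have hfi : IsIdempotentElem f := by
    change f * f = f
    rw [hθ, smul_mul_smul_comm, sub_mul, mul_sub, mul_sub, hss, one_mul, one_mul, mul_one]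
    module
  have hf1 : theta φ (1 - e) = 1 - f := eq_sub_of_add_eq' hadd
  have hf0 : f ≠ 0 := by
    intro h
    rw [h, smul_zero, sub_zero] at hfs
    refine he0 (symUnit_eq_one he (φ.injective (Units.ext ?_)))
    rw [← hs, hfs, map_one, Units.val_one]
  have hf1' : (1 - f) ≠ 0 := by
    intro h
    have hs1 : s = -1 := by
      rw [hfs, ← sub_eq_zero.1 h]
      module
    have h1 : 1 - e = 0 := symUnit_eq_one he' (φ.injective (Units.ext (by
      rw [hsym, Units.val_neg, ← hs, hs1, neg_neg, map_one, Units.val_one])))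
    exact he1 (sub_eq_zero.1 h1).symm
  let W : ℂˣ →* B :=
    (Units.coeHom B).comp (φ.toMonoidHom.comp (idempotentUnits he))
  have hWval : ∀ t, W t = φ (idempotentUnits he t) := fun _ => rfl
  have hW : ∀ t x, Commute x f → Commute (W t) x := by
    intro t x hx
    refine commute_of_commute_units (s := s) ?_ (x := x) ?_
    · intro u hu
      obtain ⟨v, rfl⟩ := φ.surjective u
      have h1 : v * symUnit he = symUnit he * v := φ.injective (by
        rw [map_mul, map_mul]
        exact Units.ext hu)
      have h2 : Commute (v : A) e := commute_of_commute_symUnit he (congrArg Units.val h1)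
      have h3 : idempotentUnits he t * v = v * idempotentUnits he t := Units.ext (by
        rw [Units.val_mul, Units.val_mul, idempotentUnits_val]
        exact ((((h2.smul_right _).add_right (Commute.one_right _)).sub_right h2).eq).symm)
      rw [hWval]
      exact congrArg Units.val (show φ _ * φ v = φ v * φ _ by rw [← map_mul, h3, map_mul])
    · rw [hfs]
      exact (Commute.one_right x).sub_right (hx.smul_right _)
  obtain ⟨a, ha⟩ := exists_character W hf0
    (fun t => exists_mul_idempotent_eq_smul hfi hf0 (hW t))
  obtain ⟨b, hb⟩ := exists_character W hf1'
    (fun t => exists_mul_idempotent_eq_smul hfi.one_sub hf1' (fun x hx => hW t x (by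
      simpa using (Commute.one_right x).sub_right hx)))
  refine ⟨a, b, fun t v hv => ?_⟩
  obtain rfl : v = idempotentUnits he t := Units.ext hv
  rw [← hf, hf1, ← ha, ← hb, ← mul_add, add_sub_cancel, mul_one, hWval]

end
end

section
/- Let A and B be simple unital complex C*-algebras, φ : GL(A) → GL(B) a group isomorphism, and θ the induced map on idempotents. Suppose e, f ∈ Ĩ(A) are orthogonal nontrivial idempotents with e + f ≠ 1 that are ∼_c-equivalent (c_e = c_f for some, equivalently any, choice of coefficient maps). Then exactly one of the two equalities θ(e)θ(f) = 0 and θ(1 − e)θ(1 − f) = 0 holds. -/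
noncomputable section

variable {A B : Type*}
  [NormedRing A] [StarRing A] [CStarRing A] [CompleteSpace A]
  [NormedAlgebra ℂ A] [StarModule ℂ A]
  [NormedRing B] [StarRing B] [CStarRing B] [CompleteSpace B]
  [NormedAlgebra ℂ B] [StarModule ℂ B]

section Idempotents

variable {R S : Type*} [Ring R] [Ring S]

/-- Simple rings are prime. -/
theorem eq_zero_or_eq_zero_of_forall_mul_mul_eq_zero [IsSimpleRing R] {a b : R}
    (h : ∀ x, a * x * b = 0) : a = 0 ∨ b = 0 := by
  let I : TwoSidedIdeal R := TwoSidedIdeal.mk' {y | ∀ x, a * x * y = 0}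
    (fun x => mul_zero _)
    (fun hy hz x => by rw [mul_add, hy x, hz x, add_zero])
    (fun hy x => by rw [mul_neg, hy x, neg_zero])
    (fun {z y} hy x => by rw [← mul_assoc, mul_assoc a x z, hy])
    (fun {y z} hy x => by rw [← mul_assoc, hy x, zero_mul])
  have mem (y : R) : y ∈ I ↔ ∀ x, a * x * y = 0 := TwoSidedIdeal.mem_mk' ..
  rcases eq_bot_or_eq_top I with hI | hI
  · right
    have hb := (mem b).2 h
    rwa [hI, TwoSidedIdeal.mem_bot] at hb
  · left
    have h1 : (1 : R) ∈ I := hI ▸ trivial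
    simpa using (mem 1).1 h1 1

/-- In a simple ring, an element acting as the scalars `α`, `β` on two orthogonal nonzero
idempotents `p`, `q` and commuting with the units `1 + p x q` has `α = β`. -/
theorem scalar_eq_of_commute_one_add [IsSimpleRing R] [Algebra ℂ R] {p q U : R} {α β : ℂ}
    (hqp : q * p = 0) (hUp : U * p = α • p) (hUq : q * U = β • q)
    (hU : ∀ (x : R) (u : Rˣ), (u : R) = 1 + p * x * q → Commute U u) :
    α = β ∨ p = 0 ∨ q = 0 := by
  by_cases hαβ : α = β
  · exact .inl hαβ
  refine .inr (eq_zero_or_eq_zero_of_forall_mul_mul_eq_zero fun x => ?_)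
  have hn : IsNilpotent (p * x * q) := by
    refine ⟨2, ?_⟩
    have : (p * x * q) ^ 2 = p * x * (q * p) * (x * q) := by noncomm_ring
    rw [this, hqp]; simp
  obtain ⟨u, hu⟩ := hn.isUnit_one_add
  have hc := hU x u hu
  rw [hu, commute_iff_eq, mul_add, add_mul, mul_one, one_mul, add_right_inj, ← mul_assoc,
    ← mul_assoc, hUp, mul_assoc (p * x), hUq, smul_mul_assoc, smul_mul_assoc,
    mul_smul_comm, ← sub_eq_zero, ← sub_smul] at hc
  exact (smul_eq_zero.1 hc).resolve_left (sub_ne_zero.2 hαβ)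

/-- In a simple ring, an idempotent commuting with all units is trivial. -/
theorem IsIdempotentElem.eq_zero_or_one_of_commute_units [IsSimpleRing R] [Algebra ℂ R] {h : R}
    (hh : IsIdempotentElem h) (hc : ∀ u : Rˣ, Commute h u) : h = 0 ∨ h = 1 := by
  have h' : h * h = h := hh
  rcases scalar_eq_of_commute_one_add (p := h) (q := 1 - h) (U := h) (α := 1) (β := 0)
    (by rw [sub_mul, one_mul, h', sub_self]) (by rw [one_smul, h'])
    (by rw [sub_mul, one_mul, h', sub_self, zero_smul]) (fun _ u _ => hc u) with h0 | h0 | h0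
  · exact absurd h0 one_ne_zero
  · exact .inl h0
  · exact .inr (sub_eq_zero.1 h0).symm

variable [Algebra ℂ S]

theorem coe_map_symUnit (φ : Rˣ → Sˣ) {e : R} (he : IsIdempotentElem e) :
    (φ (symUnit he) : S) = 1 - 2 * theta φ e := by
  rw [theta, dif_pos he, two_mul, ← add_smul]
  norm_num

theorem commute_theta {φ : Rˣ →* Sˣ} {e : R} (he : IsIdempotentElem e) {x : S}
    (hx : Commute (φ (symUnit he) : S) x) : Commute (theta φ e) x := by
  rw [theta, dif_pos he]
  exact ((Commute.one_left x).sub_left hx).smul_left _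

theorem isIdempotentElem_theta (φ : Rˣ →* Sˣ) {e : R} (he : IsIdempotentElem e) :
    IsIdempotentElem (theta φ e) := by
  have hs : (φ (symUnit he) : S) * φ (symUnit he) = 1 := by
    rw [← Units.val_mul, ← map_mul, ← Units.val_one, ← map_one φ]
    congr 2
    exact Units.ext (symUnit he).val_inv
  rw [IsIdempotentElem, theta, dif_pos he, smul_mul_smul_comm, sub_mul, mul_sub, mul_sub, hs,
    one_mul, one_mul, mul_one, ← neg_sub (1 : S), sub_neg_eq_add, ← two_smul ℂ, smul_smul]
  norm_num

variable [Algebra ℂ R] [IsSimpleRing R] [IsSimpleRing S]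

theorem map_neg_one_of_isSimpleRing (φ : Rˣ ≃* Sˣ) : φ (-1) = -1 := by
  have h1 : IsIdempotentElem (1 : R) := .one
  have hs : symUnit h1 = -1 := Units.ext (by simp only [symUnit]; norm_num)
  have hval := coe_map_symUnit φ h1
  rw [hs] at hval
  have hc (u : Sˣ) : Commute (theta φ (1 : R)) (u : S) := by
    refine commute_theta (φ := φ.toMonoidHom) h1 ?_
    rw [hs, Commute.units_val_iff, ← φ.apply_symm_apply u]
    exact (Commute.neg_one_left _).map φ
  rcases (isIdempotentElem_theta φ.toMonoidHom h1).eq_zero_or_one_of_commute_units hc with h | h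
  · have : φ (-1) = φ 1 := by
      rw [map_one]
      exact Units.ext (by rw [hval, show theta φ (1 : R) = 0 from h]; simp)
    have h2 : (-1 : R) = 1 := by simpa using congrArg Units.val (φ.injective this)
    have h3 : (1 : R) = (2 : ℂ)⁻¹ • (1 - -1) := by module
    rw [h2, sub_self, smul_zero] at h3
    exact absurd h3 one_ne_zero
  · exact Units.ext (by rw [hval, show theta φ (1 : R) = 1 from h]; norm_num)

theorem theta_one_sub (φ : Rˣ ≃* Sˣ) {e : R} (he : IsIdempotentElem e) :
    theta φ (1 - e) = 1 - theta φ e := by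
  have hs : symUnit he.one_sub = -1 * symUnit he :=
    Units.ext (by simp only [symUnit, Units.val_mul, Units.val_neg, Units.val_one]; noncomm_ring)
  rw [theta, dif_pos he.one_sub, theta, dif_pos he, hs, map_mul, map_neg_one_of_isSimpleRing]
  simp only [Units.val_neg, neg_mul, one_mul]
  module

theorem theta_add_theta_eq_one_iff (φ : Rˣ ≃* Sˣ) {e f : R} (he : IsIdempotentElem e)
    (hf : IsIdempotentElem f) : theta φ e + theta φ f = 1 ↔ e + f = 1 := by
  refine ⟨fun h => ?_, fun h => ?_⟩
  · have hφ : φ (symUnit hf) = φ (symUnit he.one_sub) := Units.ext <| by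
      rw [coe_map_symUnit φ hf, coe_map_symUnit φ he.one_sub, theta_one_sub φ he,
        eq_sub_of_add_eq' h]
    have hv : 1 - 2 * f = 1 - 2 * (1 - e) := congrArg Units.val (φ.injective hφ)
    have hhalf (x : R) : (2 : ℂ)⁻¹ • (1 - (1 - 2 * x)) = x := by rw [two_mul]; module
    rw [← hhalf f, hv, hhalf, add_sub_cancel]
  · obtain rfl : f = 1 - e := eq_sub_of_add_eq' h
    rw [theta_one_sub φ he, add_sub_cancel]

end Idempotents

section OneAdd

variable {R : Type*} [Ring R] [Algebra ℂ R]

/-- The unit `1 + e` associated to an idempotent `e`. -/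
def IsIdempotentElem.oneAddUnit {e : R} (he : IsIdempotentElem e) : Rˣ where
  val := 1 + e
  inv := 1 - (2 : ℂ)⁻¹ • e
  val_inv := by
    have h : e * e = e := he
    simp only [add_mul, mul_sub, one_mul, mul_one, mul_smul_comm, h]
    module
  inv_val := by
    have h : e * e = e := he
    simp only [mul_add, sub_mul, one_mul, mul_one, smul_mul_assoc, h]
    module

theorem IsCoeffMaps.map_oneAddUnit {S : Type*} [Ring S] [Algebra ℂ S] [IsSimpleRing R]
    [IsSimpleRing S] {φ : Rˣ ≃* Sˣ} {e : R} {a b : ℂˣ →* ℂˣ} (h : IsCoeffMaps φ e a b)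
    (he : IsIdempotentElem e) :
    (φ he.oneAddUnit : S) = ((a (Units.mk0 2 two_ne_zero) : ℂˣ) : ℂ) • theta φ e
      + ((b (Units.mk0 2 two_ne_zero) : ℂˣ) : ℂ) • (1 - theta φ e) := by
  rw [← theta_one_sub φ he]
  refine h _ _ ?_
  simp only [IsIdempotentElem.oneAddUnit, Units.val_mk0]
  module

/-- If the image of `1 + e` squares to a scalar, then `e` is trivial. -/
theorem eq_zero_or_one_of_map_oneAddUnit_sq {S : Type*} [Ring S] [Algebra ℂ S] [IsSimpleRing R]
    (φ : Rˣ ≃* Sˣ) {e : R} (he : IsIdempotentElem e) {γ : ℂ}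
    (h : (φ he.oneAddUnit : S) * φ he.oneAddUnit = γ • 1) : e = 0 ∨ e = 1 := by
  refine he.eq_zero_or_one_of_commute_units fun u => ?_
  have hS : Commute (φ (he.oneAddUnit * he.oneAddUnit) : S) (φ u) := by
    rw [map_mul, Units.val_mul, h]
    exact (Commute.one_left _).smul_left γ
  have hR : Commute ((he.oneAddUnit * he.oneAddUnit : Rˣ) : R) (u : R) :=
    Commute.units_val_iff.2 <| by simpa using (Commute.units_val_iff.1 hS).map φ.symm
  have h' : e * e = e := he
  have hval : e = (3 : ℂ)⁻¹ • (((he.oneAddUnit * he.oneAddUnit : Rˣ) : R) - 1) := by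
    simp only [IsIdempotentElem.oneAddUnit, Units.val_mul, mul_add, add_mul, one_mul, mul_one, h']
    module
  rw [hval]
  exact (hR.sub_left (Commute.one_left _)).smul_left _

end OneAdd

/-- A unit of `S` commuting with the image of the symmetry `1 - 2(e + f)` commutes with the
image of `1 + e + f`, for orthogonal idempotents `e` and `f`. -/
theorem commute_map_oneAddUnit_mul {R S : Type*} [Ring R] [Ring S] [Algebra ℂ R]
    (φ : Rˣ ≃* Sˣ) {e f : R} (he : IsIdempotentElem e) (hf : IsIdempotentElem f)
    (hef : e * f = 0) {u : Sˣ} (hu : Commute (φ (symUnit he * symUnit hf)) u) :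
    Commute (φ (he.oneAddUnit * hf.oneAddUnit)) u := by
  have hR : Commute ((symUnit he * symUnit hf : Rˣ) : R) (φ.symm u : Rˣ) :=
    Commute.units_val_iff.2 <| by simpa only [φ.symm_apply_apply] using hu.map φ.symm
  have hval : ((he.oneAddUnit * hf.oneAddUnit : Rˣ) : R)
      = 1 + (2 : ℂ)⁻¹ • (1 - ((symUnit he * symUnit hf : Rˣ) : R)) := by
    simp only [symUnit, IsIdempotentElem.oneAddUnit, Units.val_mul, two_mul, mul_add, add_mul,
      mul_sub, sub_mul, one_mul, mul_one, hef]
    module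
  have hc : Commute ((he.oneAddUnit * hf.oneAddUnit : Rˣ) : R) (φ.symm u : Rˣ) := by
    rw [hval]
    exact (Commute.one_left _).add_left (((Commute.one_left _).sub_left hR).smul_left _)
  simpa only [φ.apply_symm_apply] using (Commute.units_val_iff.1 hc).map φ

theorem statement9 [IsSimpleRing A] [IsSimpleRing B] (φ : Aˣ ≃* Bˣ)
    (e f : A) (he : IsIdempotentElem e) (he0 : e ≠ 0) (he1 : e ≠ 1)
    (hf : IsIdempotentElem f) (hf0 : f ≠ 0) (hf1 : f ≠ 1)
    (hef : e * f = 0) (hfe : f * e = 0) (hone : e + f ≠ 1)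
    (ae be af bf : ℂˣ →* ℂˣ)
    (hce : IsCoeffMaps (⇑φ) e ae be) (hcf : IsCoeffMaps (⇑φ) f af bf)
    (hcc : ∀ lam : ℂˣ, cOf ae be lam = cOf af bf lam) :
    Xor' (theta (⇑φ) e * theta (⇑φ) f = 0)
      (theta (⇑φ) (1 - e) * theta (⇑φ) (1 - f) = 0) := by
  have hP : theta φ e * theta φ e = theta φ e := isIdempotentElem_theta φ.toMonoidHom he
  have hQ : theta φ f * theta φ f = theta φ f := isIdempotentElem_theta φ.toMonoidHom hf
  have hsφ : Commute (φ (symUnit he)) (φ (symUnit hf)) := by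
    refine Commute.map (Units.ext ?_) φ
    simp only [symUnit, Units.val_mul, two_mul, mul_add, add_mul, mul_sub, sub_mul, one_mul,
      mul_one, hef, hfe]
    abel
  have hPQ : theta φ e * theta φ f = theta φ f * theta φ e :=
    commute_theta (φ := φ.toMonoidHom) he
      (commute_theta (φ := φ.toMonoidHom) hf (Commute.units_val_iff.2 hsφ).symm).symm
  have hUe := hce.map_oneAddUnit he
  have hUf := hcf.map_oneAddUnit hf
  have hsum := (theta_add_theta_eq_one_iff φ he hf).not.2 hone
  have hse := coe_map_symUnit φ he
  have hsf := coe_map_symUnit φ hf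
  have hcc2 := congrArg Units.val (hcc (Units.mk0 2 two_ne_zero))
  simp only [cOf, Units.val_mul, Units.val_inv_eq_inv_val] at hcc2
  have hb0 := (be (Units.mk0 2 two_ne_zero)).ne_zero
  have hb0' := (bf (Units.mk0 2 two_ne_zero)).ne_zero
  rw [theta_one_sub φ he, theta_one_sub φ hf]
  have ha0' := (af (Units.mk0 2 two_ne_zero)).ne_zero
  generalize ((ae (Units.mk0 2 two_ne_zero) : ℂˣ) : ℂ) = a at *
  generalize ((be (Units.mk0 2 two_ne_zero) : ℂˣ) : ℂ) = b at *
  generalize ((af (Units.mk0 2 two_ne_zero) : ℂˣ) : ℂ) = a' at *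
  generalize ((bf (Units.mk0 2 two_ne_zero) : ℂˣ) : ℂ) = b' at *
  generalize theta φ e = P at *
  generalize theta φ f = Q at *
  have hPQP : P * Q * P = P * Q := by rw [mul_assoc, ← hPQ, ← mul_assoc, hP]
  have hQPQ : Q * (P * Q) = P * Q := by rw [← mul_assoc, ← hPQ, mul_assoc, hQ]
  have hPPQ : P * (P * Q) = P * Q := by rw [← mul_assoc, hP]
  have hPQQ : P * Q * Q = P * Q := by rw [mul_assoc, hQ]
  have key : a * a' = b * b' ∨ P * Q = 0 ∨ (1 - P) * (1 - Q) = 0 := by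
    refine scalar_eq_of_commute_one_add
      (U := ((φ (he.oneAddUnit * hf.oneAddUnit) : Bˣ) : B)) ?_ ?_ ?_ fun x u hu => ?_
    · simp only [sub_mul, mul_sub, one_mul, mul_one, hPPQ, hQPQ, mul_assoc]
      abel
    · simp only [map_mul, Units.val_mul, hUe, hUf, sub_mul, mul_sub, add_mul, mul_add, one_mul,
        mul_one, smul_mul_assoc, mul_smul_comm, mul_assoc, hPPQ, hQPQ, smul_sub]
      module
    · simp only [map_mul, Units.val_mul, hUe, hUf, sub_mul, mul_sub, add_mul, mul_add, one_mul,
        mul_one, smul_mul_assoc, mul_smul_comm, ← mul_assoc, ← hPQ, hPQP, hPQQ, hP, hQ, smul_sub]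
      module
    · refine Commute.units_val_iff.2 (commute_map_oneAddUnit_mul φ he hf hef ?_)
      rw [← Commute.units_val_iff, hu, map_mul, Units.val_mul, hse, hsf]
      refine (Commute.one_right _).add_right ?_
      have h1 : (1 - 2 * P) * (1 - 2 * Q) * (P * Q) = P * Q := by
        simp only [two_mul, sub_mul, mul_sub, add_mul, mul_add, one_mul, mul_one, mul_assoc,
          hPPQ, hQPQ]
        abel
      have h2 : (1 - P) * (1 - Q) * ((1 - 2 * P) * (1 - 2 * Q)) = (1 - P) * (1 - Q) := by
        simp only [two_mul, sub_mul, mul_sub, add_mul, mul_add, one_mul, mul_one, ← mul_assoc,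
          ← hPQ, hPQP, hPQQ, hP, hQ]
        abel
      rw [commute_iff_eq, mul_assoc (P * Q * x), h2, ← mul_assoc _ (P * Q * x),
        ← mul_assoc _ (P * Q), h1]
  have hne : a * a' ≠ b * b' := by
    intro hab
    have hsq : b * b = a * a := by
      have h1 : a * b' = a' * b := by field_simp at hcc2; linear_combination hcc2
      refine mul_right_cancel₀ (mul_ne_zero ha0' hb0') ?_
      linear_combination (a * b') * (-hab) + (b * b') * (-h1)
    rcases eq_zero_or_one_of_map_oneAddUnit_sq (γ := a * a) φ he (by
      have hU : (a • P + b • (1 - P)) * (a • P + b • (1 - P))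
          = (a * a) • P + (b * b) • (1 - P) := by
        simp only [sub_mul, mul_sub, add_mul, mul_add, one_mul, mul_one, smul_mul_assoc,
          mul_smul_comm, hP, smul_sub]
        module
      rw [hUe, hU, hsq, ← smul_add, add_sub_cancel]) with h | h
    exacts [he0 h, he1 h]
  have hnot : ¬(P * Q = 0 ∧ (1 - P) * (1 - Q) = 0) := by
    rintro ⟨h1, h2⟩
    refine hsum ?_
    simp only [sub_mul, mul_sub, one_mul, mul_one, h1] at h2
    rw [← sub_eq_zero, ← neg_eq_zero, ← h2]
    abel
  rcases key.resolve_left hne with h | h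
  · exact .inl ⟨h, fun h' => hnot ⟨h, h'⟩⟩
  · exact .inr ⟨h, fun h' => hnot ⟨h', h⟩⟩

end
end
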